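/- (Williamson's theorem) Let M be a real symmetric positive-definite 2m×2m matrix and Ω = ⊕_{k=1}^m ω with ω = [[0,1],[-1,0]]. Then there exist a real 2m×2m matrix S with S Ω Sᵀ = Ω and positive real numbers ν₁, …, ν_m such that M = S (⊕_{k=1}^m ν_k I₂) Sᵀ, where I₂ is the 2×2 identity matrix. -/

import Mathlib

open Matrix

/-- The 2×2 standard symplectic form ω = [[0,1],[-1,0]]. -/
def omega2 : Matrix (Fin 2) (Fin 2) ℝ := !![0, 1; -1, 0]

/-- The 2m×2m symplectic form Ω = ⊕_{k=1}^m ω. -/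
def Omega (m : ℕ) : Matrix (Fin 2 × Fin m) (Fin 2 × Fin m) ℝ :=
  Matrix.blockDiagonal fun _ : Fin m => omega2

open scoped InnerProductSpace in
/-- An injective skew-adjoint operator on a real inner product space of dimension `2 * m` is, in a
suitable orthonormal family, a direct sum of positive multiples of plane rotations by a right
angle. -/
theorem exists_orthonormal_of_isSkew_injective {V : Type*} [NormedAddCommGroup V]
    [InnerProductSpace ℝ V] [FiniteDimensional ℝ V] (m : ℕ)
    (hV : Module.finrank ℝ V = 2 * m) (A : V →ₗ[ℝ] V)
    (hA : ∀ x y, ⟪A x, y⟫_ℝ = -⟪x, A y⟫_ℝ) (hinj : Function.Injective A) :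
    ∃ (b : Fin 2 × Fin m → V) (c : Fin m → ℝ), Orthonormal ℝ b ∧ (∀ k, 0 < c k) ∧
      (∀ k, A (b (0, k)) = -(c k • b (1, k))) ∧ ∀ k, A (b (1, k)) = c k • b (0, k) := by
  induction m generalizing V with
  | zero => exact ⟨fun p => p.2.elim0, fun k => k.elim0, ⟨fun p => p.2.elim0, fun p => p.2.elim0⟩,
      fun k => k.elim0, fun k => k.elim0, fun k => k.elim0⟩
  | succ m ih =>
    have hT : (A ∘ₗ A).IsSymmetric := fun x y => by simp [hA]
    let i : Fin (2 * (m + 1)) := ⟨0, by omega⟩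
    obtain ⟨e, l, he, hel⟩ : ∃ (e : V) (l : ℝ), ‖e‖ = 1 ∧ A (A e) = l • e :=
      ⟨hT.eigenvectorBasis hV i, hT.eigenvalues hV i, (hT.eigenvectorBasis hV).norm_eq_one i,
        hT.apply_eigenvectorBasis hV i⟩
    set c := ‖A e‖ with hc
    have hcpos : 0 < c := by
      rw [hc, norm_pos_iff, ne_eq, map_eq_zero_iff A hinj]
      rintro rfl
      simp at he
    have hl : l = -c ^ 2 := by
      have := hA e (A e)
      rw [hel, real_inner_self_eq_norm_sq, inner_smul_right, real_inner_self_eq_norm_sq, he] at this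
      linarith
    let f : V := -(c⁻¹ • A e)
    have hAe : A e = -(c • f) := by simp [f, smul_smul, hcpos.ne']
    have hAf : A f = c • e := by
      simp only [f, map_smul, hel, hl, smul_smul, ← neg_smul]
      congr 1
      field_simp
    have hf : ‖f‖ = 1 := by
      simp [f, norm_smul, ← hc, hcpos.ne', abs_of_pos hcpos]
    have hef : ⟪e, f⟫_ℝ = 0 := by
      have h := hA e e
      rw [real_inner_comm] at h
      simp only [f, inner_neg_right, inner_smul_right]
      rw [show ⟪e, A e⟫_ℝ = 0 by linarith]
      simp
    have hon : Orthonormal ℝ ![e, f] := by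
      rw [orthonormal_iff_ite]
      intro i j
      fin_cases i <;> fin_cases j <;> simp [he, hf, hef, real_inner_comm e f]
    let W : Submodule ℝ V := (Submodule.span ℝ (Set.range ![e, f]))ᗮ
    have hmem : ∀ x, x ∈ W ↔ ⟪e, x⟫_ℝ = 0 ∧ ⟪f, x⟫_ℝ = 0 := fun x => by
      rw [Submodule.mem_orthogonal]
      refine ⟨fun h => ⟨h e (Submodule.subset_span ⟨0, rfl⟩), h f (Submodule.subset_span ⟨1, rfl⟩)⟩,
        fun h u hu => ?_⟩
      induction hu using Submodule.span_induction with
      | mem u hu => obtain ⟨i, rfl⟩ := hu; fin_cases i <;> simp [h.1, h.2]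
      | zero => simp
      | add u v _ _ hu hv => simp [inner_add_left, hu, hv]
      | smul a u _ hu => simp [inner_smul_left, hu]
    have hAW : ∀ x ∈ W, A x ∈ W := fun x hx => by
      rw [hmem] at hx ⊢
      have h1 := hA e x
      have h2 := hA f x
      rw [hAe, inner_neg_left, inner_smul_left, hx.2, mul_zero, neg_zero] at h1
      rw [hAf, inner_smul_left, hx.1, mul_zero] at h2
      exact ⟨neg_eq_zero.1 h1.symm, neg_eq_zero.1 h2.symm⟩
    have hW : Module.finrank ℝ W = 2 * m := by
      have h1 := (Submodule.span ℝ (Set.range ![e, f])).finrank_add_finrank_orthogonal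
      have h2 := finrank_span_eq_card hon.linearIndependent
      simp only [Fintype.card_fin] at h2
      change _ + Module.finrank ℝ W = _ at h1
      omega
    obtain ⟨b, d, hb, hd, hb0, hb1⟩ := ih hW (A.restrict hAW) (fun x y => hA x y)
      (fun x y h => Subtype.ext (hinj (congrArg Subtype.val h)))
    refine ⟨fun p => Fin.cases (![e, f] p.1) (fun k => (b (p.1, k) : V)) p.2, Fin.cons c d,
      ?_, ?_, ?_, ?_⟩
    · rw [orthonormal_iff_ite] at hb hon ⊢
      have hperp : ∀ i q, ⟪![e, f] i, (b q : V)⟫_ℝ = 0 := fun i q => by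
        have := (hmem _).1 (b q).2
        fin_cases i
        exacts [this.1, this.2]
      rintro ⟨i, k⟩ ⟨j, l⟩
      cases k using Fin.cases <;> cases l using Fin.cases
      · simpa using hon i j
      · simpa [Fin.succ_ne_zero, (Fin.succ_ne_zero _).symm] using hperp i _
      · rw [real_inner_comm]
        simpa [Fin.succ_ne_zero] using hperp j _
      · simpa using hb (i, _) (j, _)
    · intro k
      cases k using Fin.cases
      · exact hcpos
      · exact hd _
    · intro k
      cases k using Fin.cases
      · exact hAe
      · exact congrArg Subtype.val (hb0 _)
    · intro k
      cases k using Fin.cases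
      · exact hAf
      · exact congrArg Subtype.val (hb1 _)

/-- A nonsingular real skew-symmetric matrix is orthogonally similar to a block diagonal matrix
whose blocks are positive multiples of `omega2`. -/
theorem exists_orthogonal_mul_blockDiagonal_of_isSkew (m : ℕ)
    (K : Matrix (Fin 2 × Fin m) (Fin 2 × Fin m) ℝ) (hK : Kᵀ = -K) (hunit : IsUnit K) :
    ∃ (O : Matrix (Fin 2 × Fin m) (Fin 2 × Fin m) ℝ) (c : Fin m → ℝ), Oᵀ * O = 1 ∧
      (∀ k, 0 < c k) ∧ K * O = O * blockDiagonal fun k => c k • omega2 := by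
  obtain ⟨b, c, hb, hc, hb0, hb1⟩ := exists_orthonormal_of_isSkew_injective
    (V := EuclideanSpace ℝ (Fin 2 × Fin m)) m (by simp) (toEuclideanLin K)
    (fun x y => by
      simp only [EuclideanSpace.inner_eq_star_dotProduct, toLpLin_apply, star_trivial]
      rw [dotProduct_mulVec, ← mulVec_transpose, hK, neg_mulVec, neg_dotProduct, dotProduct_comm])
    (fun x y h => by
      simp only [toLpLin_apply] at h
      exact WithLp.ofLp_injective 2 (mulVec_injective_of_isUnit hunit (WithLp.toLp_injective 2 h)))
  refine ⟨of fun i j => b j i, c, ?_, hc, ?_⟩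
  · ext i j
    have h := orthonormal_iff_ite.1 hb i j
    rw [EuclideanSpace.inner_eq_star_dotProduct, star_trivial, dotProduct_comm] at h
    rw [one_apply, ← h]
    rfl
  · ext i ⟨j, k⟩
    have h0 := congrArg (fun v : EuclideanSpace ℝ _ => v i) (hb0 k)
    have h1 := congrArg (fun v : EuclideanSpace ℝ _ => v i) (hb1 k)
    simp only [toLpLin_apply, mulVec, dotProduct, PiLp.neg_apply, PiLp.smul_apply,
      smul_eq_mul] at h0 h1
    simp only [mul_apply, Fintype.sum_prod_type, of_apply, blockDiagonal_apply] at h0 h1 ⊢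
    fin_cases j
    · simp [h0, omega2, mul_comm]
    · simp [h1, omega2, mul_comm]

open scoped MatrixOrder Matrix.Norms.L2Operator in
/-- A real positive definite matrix is of the form `R * Rᵀ` with `R` invertible. -/
theorem Matrix.PosDef.exists_isUnit_mul_transpose {n : Type*} [Fintype n] [DecidableEq n]
    {M : Matrix n n ℝ} (hM : M.PosDef) : ∃ R : Matrix n n ℝ, IsUnit R ∧ M = R * Rᵀ := by
  obtain ⟨B, hB, rfl⟩ := CStarAlgebra.isStrictlyPositive_iff_eq_star_mul_self.mp
    hM.isStrictlyPositive
  refine ⟨star B, hB.star, ?_⟩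
  simp [star_eq_conjTranspose, conjTranspose_eq_transpose_of_trivial]

theorem Omega_transpose (m : ℕ) : (Omega m)ᵀ = -Omega m := by
  rw [Omega, blockDiagonal_transpose, ← blockDiagonal_neg]
  congr 1
  ext k i j
  fin_cases i <;> fin_cases j <;> simp [omega2]

theorem isUnit_Omega (m : ℕ) : IsUnit (Omega m) := by
  refine IsUnit.of_mul_eq_one (-Omega m) ?_
  rw [Omega, ← blockDiagonal_neg, ← blockDiagonal_mul, ← blockDiagonal_one]
  congr 1
  ext k i j
  fin_cases i <;> fin_cases j <;> simp [omega2]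

/-- Williamson's theorem: any real symmetric positive-definite 2m×2m matrix M
can be written as M = S (⊕_k ν_k I₂) Sᵀ with S symplectic and ν_k > 0. -/
theorem williamson (m : ℕ) (M : Matrix (Fin 2 × Fin m) (Fin 2 × Fin m) ℝ)
    (hsymm : M.IsSymm) (hpos : M.PosDef) :
    ∃ (S : Matrix (Fin 2 × Fin m) (Fin 2 × Fin m) ℝ) (ν : Fin m → ℝ),
      S * Omega m * Sᵀ = Omega m ∧ (∀ k, 0 < ν k) ∧
      M = S * (Matrix.blockDiagonal fun k : Fin m => ν k • (1 : Matrix (Fin 2) (Fin 2) ℝ)) * Sᵀ := by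
  obtain ⟨R, hR, hM⟩ := hpos.exists_isUnit_mul_transpose
  have hR1 : R * R⁻¹ = 1 := mul_nonsing_inv R ((isUnit_iff_isUnit_det R).1 hR)
  have hR2 : (R⁻¹)ᵀ * Rᵀ = 1 := by rw [← transpose_mul, hR1, transpose_one]
  have hRinv : IsUnit R⁻¹ := isUnit_nonsing_inv_iff.2 hR
  obtain ⟨O, c, hO, hc, hKO⟩ := exists_orthogonal_mul_blockDiagonal_of_isSkew m
    (R⁻¹ * Omega m * (R⁻¹)ᵀ)
    (by simp [transpose_mul, Omega_transpose, Matrix.mul_assoc])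
    ((hRinv.mul (isUnit_Omega m)).mul ((isUnit_transpose _).2 hRinv))
  have hO' : O * Oᵀ = 1 := mul_eq_one_comm.1 hO
  set E : Matrix (Fin 2 × Fin m) (Fin 2 × Fin m) ℝ :=
    blockDiagonal fun k => √(c k) • (1 : Matrix (Fin 2) (Fin 2) ℝ) with hE
  have hEt : Eᵀ = E := by simp [hE, blockDiagonal_transpose]
  have hEΩ : E * Omega m * E = blockDiagonal fun k => c k • omega2 := by
    simp [hE, Omega, ← blockDiagonal_mul, smul_smul, Real.mul_self_sqrt (hc _).le]
  have hED : E * (blockDiagonal fun k => (c k)⁻¹ • (1 : Matrix (Fin 2) (Fin 2) ℝ)) * E = 1 := by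
    rw [hE, ← blockDiagonal_mul, ← blockDiagonal_mul, ← blockDiagonal_one]
    congr 1
    ext1 k
    have h : √(c k) * ((c k)⁻¹ * √(c k)) = 1 := by
      rw [mul_left_comm, Real.mul_self_sqrt (hc k).le, inv_mul_cancel₀ (hc k).ne']
    simp [smul_smul, h]
  refine ⟨R * O * E, fun k => (c k)⁻¹, ?_, fun k => inv_pos.2 (hc k), ?_⟩
  · calc R * O * E * Omega m * (R * O * E)ᵀ
        = R * (O * (E * Omega m * E)) * Oᵀ * Rᵀ := by
          simp only [transpose_mul, hEt, Matrix.mul_assoc]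
      _ = (R * R⁻¹) * Omega m * ((R⁻¹)ᵀ * (O * Oᵀ) * Rᵀ) := by
          rw [hEΩ, ← hKO]
          simp only [Matrix.mul_assoc]
      _ = Omega m := by rw [hO', Matrix.mul_one, hR1, hR2, Matrix.one_mul, Matrix.mul_one]
  · calc M = R * O * 1 * Oᵀ * Rᵀ := by
          rw [Matrix.mul_one, Matrix.mul_assoc R, hO', Matrix.mul_one, hM]
      _ = _ := by
          rw [← hED]
          simp only [transpose_mul, hEt, Matrix.mul_assoc]
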